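/- Fix ε ∈ (0, 2/3). There exists a constant c > 0 such that for all sufficiently large n and k with k ≤ n^(2/3 − ε), all m, and all d satisfying max(4^(1/(1+ε))·k^1.5 / n^(1/(1+ε)), k^(ε−0.5)·√(4 log m)) ≤ d ≤ √(4 log m), the following holds: if m ≤ c·(k^1.5/d)·min(1/d², log k) and V ⊆ ℝ^n is a set of m random vectors, each independently drawn with i.i.d. standard Gaussian N(0,1) entries, then with probability at least 1/2 the set V is not (n, k, d)-balanced. -/

import Mathlib

open MeasureTheory ProbabilityTheory
open scoped NNReal ENNReal

/-- The sign function: `1` if `0 ≤ z`, `-1` otherwise. -/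
noncomputable def sgn (z : ℝ) : ℝ := if 0 ≤ z then 1 else -1

/-- `X_k(R)`: vectors in `ℝ^n` with at most `k` nonzero entries whose nonzero
entries have magnitude ratio at most `R`. -/
def sparseDR (n k : ℕ) (R : ℝ) : Set (Fin n → ℝ) :=
  {x | (Finset.univ.filter fun i => x i ≠ 0).card ≤ k ∧
       ∀ i j : Fin n, x i ≠ 0 → x j ≠ 0 → |x i| ≤ R * |x j|}

/-- `A` is a valid universal 1-bit measurement matrix for support recovery on `X_k(R)`. -/
def ValidMeas (m n k : ℕ) (R : ℝ) (A : Fin m → Fin n → ℝ) : Prop :=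
  ∀ u ∈ sparseDR n k R, ∀ v ∈ sparseDR n k R,
    Function.support u ≠ Function.support v →
      (fun i => sgn (∑ j, A i j * u j)) ≠ (fun i => sgn (∑ j, A i j * v j))

/-- `V ⊆ ℝ^n` is `(n, ℓ, d)`-balanced. -/
def IsBalanced (n ℓ : ℕ) (d : ℝ) (V : Set (Fin n → ℝ)) : Prop :=
  ∀ S : Finset (Fin n), S.card = ℓ → ∃ v ∈ V, |∑ i ∈ S, v i| ≤ d

/-- Law of a random vector in `ℝ^n` with i.i.d. standard Gaussian entries. -/
noncomputable def gaussVec (n : ℕ) : Measure (Fin n → ℝ) :=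
  Measure.pi fun _ => gaussianReal 0 1

/-- Law of `m` independent random vectors in `ℝ^n` with i.i.d. standard Gaussian entries
(equivalently, an `m × n` random matrix with i.i.d. `N(0,1)` entries). -/
noncomputable def gaussMat (m n : ℕ) : Measure (Fin m → Fin n → ℝ) :=
  Measure.pi fun _ => gaussVec n

/-- The event `F_U`: every one of the `m` vectors `v j` satisfies `|∑_{i ∈ U} (v j) i| > d`. -/
def FEvent (m n : ℕ) (d : ℝ) (U : Finset (Fin n)) : Set (Fin m → Fin n → ℝ) :=
  {v | ∀ j : Fin m, d < |∑ i ∈ U, v j i|}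

section GaussianSmallBall

lemma gaussianPDF_le (v : ℝ≥0) (x : ℝ) :
    gaussianPDF 0 v x ≤ ENNReal.ofReal (√(2 * Real.pi * v))⁻¹ := by
  apply ENNReal.ofReal_le_ofReal
  rw [gaussianPDFReal]
  refine mul_le_of_le_one_right (by positivity) (Real.exp_le_one_iff.2 ?_)
  rw [neg_div, neg_nonpos]
  positivity

lemma gaussianReal_abs_add_le (v : ℝ≥0) (hv : v ≠ 0) (a d : ℝ) :
    gaussianReal 0 v {x | |a + x| ≤ d} ≤ ENNReal.ofReal (2 * d / √(2 * Real.pi * v)) := by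
  have hset : {x : ℝ | |a + x| ≤ d} = Set.Icc (-a - d) (-a + d) := by
    ext x
    simp only [Set.mem_ofPred_eq, Set.mem_Icc, abs_le]
    constructor <;> rintro ⟨h1, h2⟩ <;> constructor <;> linarith
  rw [hset, gaussianReal_apply 0 hv]
  calc ∫⁻ x in Set.Icc (-a - d) (-a + d), gaussianPDF 0 v x
      ≤ ∫⁻ _ in Set.Icc (-a - d) (-a + d), ENNReal.ofReal (√(2 * Real.pi * v))⁻¹ :=
        lintegral_mono fun x => gaussianPDF_le v x
    _ = ENNReal.ofReal (2 * d / √(2 * Real.pi * v)) := by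
        rw [setLIntegral_const, Real.volume_Icc, ← ENNReal.ofReal_mul (by positivity)]
        congr 1
        ring

lemma le_gaussianReal_abs_le (v : ℝ≥0) (hv : v ≠ 0) {d : ℝ} (hd : 0 ≤ d) :
    ENNReal.ofReal (2 * d / √(2 * Real.pi * v) * (1 - d ^ 2 / (2 * v))) ≤
      gaussianReal 0 v {x | |x| ≤ d} := by
  have hset : {x : ℝ | |x| ≤ d} = Set.Icc (-d) d := by
    ext x
    simp only [Set.mem_ofPred_eq, Set.mem_Icc, abs_le]
  rw [hset, gaussianReal_apply 0 hv]
  calc ENNReal.ofReal (2 * d / √(2 * Real.pi * v) * (1 - d ^ 2 / (2 * v)))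
      = ∫⁻ _ in Set.Icc (-d) d,
          ENNReal.ofReal ((√(2 * Real.pi * v))⁻¹ * (1 - d ^ 2 / (2 * v))) := by
        rw [setLIntegral_const, Real.volume_Icc, mul_comm (ENNReal.ofReal _),
          ← ENNReal.ofReal_mul (by linarith)]
        congr 1
        ring
    _ ≤ ∫⁻ x in Set.Icc (-d) d, gaussianPDF 0 v x := by
        refine setLIntegral_mono (measurable_gaussianPDF 0 v) fun x hx => ?_
        apply ENNReal.ofReal_le_ofReal
        rw [gaussianPDFReal]
        gcongr
        have h1 : x ^ 2 ≤ d ^ 2 := sq_le_sq' hx.1 hx.2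
        have h2 : x ^ 2 / (2 * v) ≤ d ^ 2 / (2 * v) := by gcongr
        have h3 := Real.add_one_le_exp (-(x - 0) ^ 2 / (2 * v))
        rw [sub_zero, neg_div] at h3 ⊢
        linarith

end GaussianSmallBall

section RowSums

instance (n : ℕ) : IsProbabilityMeasure (gaussVec n) := by
  unfold gaussVec
  infer_instance

instance (m n : ℕ) : IsProbabilityMeasure (gaussMat m n) := by
  unfold gaussMat
  infer_instance

lemma iIndepFun_eval_gaussVec (n : ℕ) :
    iIndepFun (fun (i : Fin n) (x : Fin n → ℝ) => x i) (gaussVec n) :=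
  iIndepFun_pi (X := fun _ => id) fun _ => aemeasurable_id

lemma map_sum_gaussVec (n : ℕ) (S : Finset (Fin n)) :
    (gaussVec n).map (fun x => ∑ i ∈ S, x i) = gaussianReal 0 (S.card : ℝ≥0) := by
  induction S using Finset.induction_on with
  | empty => simp [Measure.map_const]
  | insert a S ha ih =>
    have h1 : (gaussVec n).map (fun x => x a) = gaussianReal 0 1 :=
      (measurePreserving_eval (fun _ : Fin n => gaussianReal 0 1) a).map_eq
    have hind : IndepFun (fun x : Fin n → ℝ => x a) (fun x => ∑ i ∈ S, x i) (gaussVec n) := by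
      have := ((iIndepFun_eval_gaussVec n).indepFun_finsetSum_of_notMem
        (fun i => measurable_pi_apply i) ha).symm
      convert this using 1
      ext x
      simp
    have h := gaussianReal_add_gaussianReal_of_indepFun hind h1 ih
    rw [add_zero] at h
    rw [Finset.card_insert_of_notMem ha]
    convert h using 2
    · ext x
      simp [Finset.sum_insert ha]
    · push_cast
      ring

lemma gaussVec_abs_sum_le (n : ℕ) (S : Finset (Fin n)) (d : ℝ) :
    gaussVec n {x | |∑ i ∈ S, x i| ≤ d} = gaussianReal 0 (S.card : ℝ≥0) {x | |x| ≤ d} := by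
  rw [← map_sum_gaussVec, Measure.map_apply (by fun_prop)
    (measurableSet_le (by fun_prop) measurable_const)]
  rfl

lemma gaussVec_abs_sum_le_inter (n : ℕ) (S T : Finset (Fin n)) (hST : (T \ S).card ≠ 0)
    (d : ℝ) :
    gaussVec n {x | |∑ i ∈ S, x i| ≤ d ∧ |∑ i ∈ T, x i| ≤ d} ≤
      ENNReal.ofReal (2 * d / √(2 * Real.pi * (T \ S).card)) *
        gaussVec n {x | |∑ i ∈ S, x i| ≤ d} := by
  set f : (Fin n → ℝ) → (ℝ × ℝ) := fun x => (∑ i ∈ S, x i, ∑ i ∈ S ∩ T, x i) with hf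
  set g : (Fin n → ℝ) → ℝ := fun x => ∑ i ∈ T \ S, x i with hg
  have hfm : Measurable f := by fun_prop
  have hgm : Measurable g := by fun_prop
  have hind : IndepFun f g (gaussVec n) := by
    have h := (iIndepFun_eval_gaussVec n).indepFun_finset S (T \ S) Finset.disjoint_sdiff
      (fun i => measurable_pi_apply i)
    have h' := h.comp
      (φ := fun y : S → ℝ => (∑ i, y i, ∑ i : S, if (i : Fin n) ∈ T then y i else 0))
      (ψ := fun y : (T \ S : Finset (Fin n)) → ℝ => ∑ i, y i)
      (Measurable.prodMk (by fun_prop) (Finset.measurable_sum _ fun i _ => by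
        split_ifs <;> fun_prop)) (by fun_prop)
    convert h' using 1
    · ext x
      · simp only [hf, Function.comp]
        exact (Finset.sum_coe_sort S x).symm
      · simp only [hf, Function.comp]
        rw [← Finset.filter_mem_eq_inter, Finset.sum_filter]
        exact (Finset.sum_coe_sort S fun i => if i ∈ T then x i else 0).symm
    · ext x
      exact (Finset.sum_coe_sort (T \ S) x).symm
  set A : Set ((ℝ × ℝ) × ℝ) := {z | |z.1.1| ≤ d ∧ |z.1.2 + z.2| ≤ d} with hA
  have hAm : MeasurableSet A :=
    (measurableSet_le (f := fun z : (ℝ × ℝ) × ℝ => |z.1.1|) (by fun_prop) measurable_const).inter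
      (measurableSet_le (f := fun z : (ℝ × ℝ) × ℝ => |z.1.2 + z.2|) (by fun_prop)
        measurable_const)
  have hpre : {x | |∑ i ∈ S, x i| ≤ d ∧ |∑ i ∈ T, x i| ≤ d} = (fun x => (f x, g x)) ⁻¹' A := by
    ext x
    have : ∑ i ∈ T, x i = ∑ i ∈ S ∩ T, x i + ∑ i ∈ T \ S, x i := by
      rw [Finset.inter_comm, Finset.sum_inter_add_sum_sdiff]
    simp [hA, hf, hg, this]
  rw [hpre, ← Measure.map_apply (hfm.prodMk hgm) hAm,
    hind.map_prod_eq_prod_map_map hfm.aemeasurable hgm.aemeasurable, Measure.prod_apply hAm,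
    show (gaussVec n).map g = gaussianReal 0 ((T \ S).card : ℝ≥0) from map_sum_gaussVec n _]
  set K := ENNReal.ofReal (2 * d / √(2 * Real.pi * (T \ S).card)) with hK
  set D : Set (ℝ × ℝ) := {z | |z.1| ≤ d}
  have hDm : MeasurableSet D := measurableSet_le (by fun_prop) measurable_const
  calc ∫⁻ z, gaussianReal 0 ((T \ S).card : ℝ≥0) (Prod.mk z ⁻¹' A) ∂(gaussVec n).map f
      ≤ ∫⁻ z, D.indicator (fun _ => K) z ∂(gaussVec n).map f := by
        refine lintegral_mono fun z => ?_
        by_cases hz : z ∈ D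
        · rw [Set.indicator_of_mem hz]
          refine (measure_mono fun y hy => hy.2).trans
            (gaussianReal_abs_add_le _ (by exact_mod_cast hST) z.2 d)
        · rw [Set.indicator_of_notMem hz]
          have : Prod.mk z ⁻¹' A = ∅ := Set.eq_empty_of_forall_notMem fun y hy => hz hy.1
          simp [this]
    _ = K * gaussVec n {x | |∑ i ∈ S, x i| ≤ d} := by
        rw [lintegral_indicator_const hDm, Measure.map_apply hfm hDm]
        rfl

end RowSums

section SecondMoment

/-- The second moment method: if the pair correlations of a finite family of events are at most
twice what they would be under independence, then some event occurs with probability at least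
`1/2`. -/
lemma half_le_measureReal_iUnion {Ω ι : Type*} [MeasurableSpace Ω] (μ : Measure Ω)
    [IsProbabilityMeasure μ] [Fintype ι] {F : ι → Set Ω} (hF : ∀ i, MeasurableSet (F i)) {M : ℝ}
    (hM : 0 < M) (hsum : ∑ i, μ.real (F i) = M)
    (hpair : ∑ i, ∑ j, μ.real (F i ∩ F j) ≤ 2 * M ^ 2) :
    1 / 2 ≤ μ.real (⋃ i, F i) := by
  have hint : ∀ A : Set Ω, MeasurableSet A → Integrable (A.indicator (1 : Ω → ℝ)) μ :=
    fun A hA => (integrable_const (1 : ℝ)).indicator hA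
  set Z : Ω → ℝ := fun ω => ∑ i, (F i).indicator (1 : Ω → ℝ) ω with hZ
  set Q : Ω → ℝ := fun ω => ∑ i, ∑ j, (F i ∩ F j).indicator (1 : Ω → ℝ) ω with hQ
  have hZint : Integrable Z μ := integrable_finsetSum _ fun i _ => hint _ (hF i)
  have hQint : Integrable Q μ := integrable_finsetSum _ fun i _ =>
    integrable_finsetSum _ fun j _ => hint _ ((hF i).inter (hF j))
  have hU : MeasurableSet (⋃ i, F i) := MeasurableSet.iUnion hF
  have hZval : ∫ ω, Z ω ∂μ = M := by
    rw [hZ, integral_finsetSum _ fun i _ => hint _ (hF i), ← hsum]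
    exact Finset.sum_congr rfl fun i _ => integral_indicator_one (hF i)
  have hQval : ∫ ω, Q ω ∂μ = ∑ i, ∑ j, μ.real (F i ∩ F j) := by
    rw [hQ, integral_finsetSum _ fun i _ =>
      integrable_finsetSum _ fun j _ => hint _ ((hF i).inter (hF j))]
    refine Finset.sum_congr rfl fun i _ => ?_
    rw [integral_finsetSum _ fun j _ => hint _ ((hF i).inter (hF j))]
    exact Finset.sum_congr rfl fun j _ => integral_indicator_one ((hF i).inter (hF j))
  have hQZ : ∀ ω, Q ω = Z ω ^ 2 := by
    intro ω
    simp only [hQ, hZ, sq, Finset.sum_mul_sum]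
    refine Finset.sum_congr rfl fun i _ => Finset.sum_congr rfl fun j _ => ?_
    rw [Set.inter_indicator_one]
    rfl
  set l : ℝ := 1 / (2 * M) with hl
  have hpt : ∀ ω, 2 * l * Z ω - l ^ 2 * Q ω ≤ (⋃ i, F i).indicator (1 : Ω → ℝ) ω := by
    intro ω
    rw [hQZ]
    by_cases h : ω ∈ ⋃ i, F i
    · rw [Set.indicator_of_mem h, Pi.one_apply]
      nlinarith [sq_nonneg (l * Z ω - 1)]
    · have hz : Z ω = 0 := Finset.sum_eq_zero fun i _ =>
        Set.indicator_of_notMem (fun hi => h (Set.mem_iUnion.2 ⟨i, hi⟩)) _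
      rw [Set.indicator_of_notMem h, hz]
      simp
  have hmono := integral_mono ((hZint.const_mul (2 * l)).sub (hQint.const_mul (l ^ 2)))
    (hint _ hU) hpt
  rw [integral_indicator_one hU] at hmono
  simp only [Pi.sub_apply] at hmono
  rw [integral_sub (hZint.const_mul _) (hQint.const_mul _), integral_const_mul,
    integral_const_mul, hZval, hQval] at hmono
  have h1 : l ^ 2 * ∑ i, ∑ j, μ.real (F i ∩ F j) ≤ l ^ 2 * (2 * M ^ 2) := by gcongr
  have h2 : 2 * l * M = 1 := by rw [hl]; field_simp
  have h3 : l ^ 2 * (2 * M ^ 2) = 1 / 2 := by rw [hl]; field_simp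
  linarith

end SecondMoment

section Transversals

/-- The map sending `i` to the element `f i` of the `i`-th of `k` disjoint blocks of size `B`. -/
def pick {n k B : ℕ} (e : Fin k × Fin B ↪ Fin n) (f : Fin k → Fin B) : Fin k ↪ Fin n where
  toFun i := e (i, f i)
  inj' _ _ h := congrArg Prod.fst (e.injective h)

lemma pick_apply {n k B : ℕ} (e : Fin k × Fin B ↪ Fin n) (f : Fin k → Fin B) (i : Fin k) :
    pick e f i = e (i, f i) := rfl

/-- The set that picks the element `f i` from the `i`-th of `k` disjoint blocks of size `B`. -/
def transversal {n k B : ℕ} (e : Fin k × Fin B ↪ Fin n) (f : Fin k → Fin B) : Finset (Fin n) :=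
  Finset.univ.map (pick e f)

lemma card_transversal {n k B : ℕ} (e : Fin k × Fin B ↪ Fin n) (f : Fin k → Fin B) :
    (transversal e f).card = k := by
  simp [transversal]

/-- The number of coordinates on which `f` and `g` agree. -/
def agreement {k B : ℕ} (f g : Fin k → Fin B) : ℕ :=
  (Finset.univ.filter fun i => f i = g i).card

lemma card_transversal_sdiff_add {n k B : ℕ} (e : Fin k × Fin B ↪ Fin n) (f g : Fin k → Fin B) :
    (transversal e g \ transversal e f).card + agreement f g = k := by
  have h : transversal e g \ transversal e f =
      (Finset.univ.filter fun i => ¬ f i = g i).map (pick e g) := by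
    ext x
    simp only [transversal, Finset.mem_sdiff, Finset.mem_map, Finset.mem_univ, true_and,
      pick_apply, Finset.mem_filter]
    constructor
    · rintro ⟨⟨i, rfl⟩, h2⟩
      exact ⟨i, fun hi => h2 ⟨i, by rw [hi]⟩, rfl⟩
    · rintro ⟨i, hi, rfl⟩
      refine ⟨⟨i, rfl⟩, ?_⟩
      rintro ⟨j, hj⟩
      have hji := e.injective hj
      simp only [Prod.mk.injEq] at hji
      obtain ⟨rfl, h⟩ := hji
      exact hi h
  rw [h, Finset.card_map, agreement, add_comm, Finset.card_filter_add_card_filter_not]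
  simp

lemma sum_pow_agreement {k B : ℕ} (f : Fin k → Fin B) (x : ℝ) :
    ∑ g : Fin k → Fin B, x ^ agreement f g = (B + (x - 1)) ^ k := by
  have h1 : ∀ g : Fin k → Fin B, x ^ agreement f g = ∏ i, if f i = g i then x else 1 := by
    intro g
    rw [agreement, Finset.prod_ite, Finset.prod_const, Finset.prod_const_one, mul_one]
  have h2 : ∀ b : Fin B, ∑ c, (if b = c then x else 1) = B + (x - 1) := by
    intro b
    have : ∀ c, (if b = c then x else 1) = 1 + if b = c then x - 1 else 0 := by
      intro c
      split_ifs <;> ring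
    simp only [this, Finset.sum_add_distrib]
    simp
  simp only [h1]
  rw [← Fintype.piFinset_univ,
    ← Finset.prod_univ_sum (fun _ => Finset.univ) fun i c => if f i = c then x else 1]
  simp [h2]

end Transversals

section Events

lemma measurableSet_FEvent (m n : ℕ) (d : ℝ) (U : Finset (Fin n)) :
    MeasurableSet (FEvent m n d U) := by
  have : FEvent m n d U = ⋂ j : Fin m, {v | d < |∑ i ∈ U, v j i|} := by
    ext v
    simp [FEvent]
  rw [this]
  exact MeasurableSet.iInter fun j => measurableSet_lt measurable_const (by fun_prop)

lemma gaussMat_real_FEvent_inter (m n : ℕ) (d : ℝ) (S T : Finset (Fin n)) :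
    (gaussMat m n).real (FEvent m n d S ∩ FEvent m n d T) =
      (gaussVec n).real {x | d < |∑ i ∈ S, x i| ∧ d < |∑ i ∈ T, x i|} ^ m := by
  have : FEvent m n d S ∩ FEvent m n d T = Set.pi Set.univ fun _ : Fin m =>
      {x : Fin n → ℝ | d < |∑ i ∈ S, x i| ∧ d < |∑ i ∈ T, x i|} := by
    ext v
    simp [FEvent, forall_and]
  rw [Measure.real, this, gaussMat, Measure.pi_pi]
  simp [Measure.real]

lemma gaussVec_real_lt_inter (n : ℕ) (d : ℝ) (S T : Finset (Fin n)) :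
    (gaussVec n).real {x | d < |∑ i ∈ S, x i| ∧ d < |∑ i ∈ T, x i|} =
      1 - (gaussVec n).real {x | |∑ i ∈ S, x i| ≤ d} - (gaussVec n).real {x | |∑ i ∈ T, x i| ≤ d}
        + (gaussVec n).real {x | |∑ i ∈ S, x i| ≤ d ∧ |∑ i ∈ T, x i| ≤ d} := by
  have hm : ∀ U : Finset (Fin n), MeasurableSet {x : Fin n → ℝ | |∑ i ∈ U, x i| ≤ d} :=
    fun U => measurableSet_le (by fun_prop) measurable_const
  have h1 : {x : Fin n → ℝ | d < |∑ i ∈ S, x i| ∧ d < |∑ i ∈ T, x i|} =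
      ({x | |∑ i ∈ S, x i| ≤ d} ∪ {x | |∑ i ∈ T, x i| ≤ d})ᶜ := by
    ext x
    simp
  have h2 : {x : Fin n → ℝ | |∑ i ∈ S, x i| ≤ d ∧ |∑ i ∈ T, x i| ≤ d} =
      {x | |∑ i ∈ S, x i| ≤ d} ∩ {x | |∑ i ∈ T, x i| ≤ d} := by
    ext x
    simp
  rw [h1, h2, probReal_compl_eq_one_sub ((hm S).union (hm T))]
  linarith [measureReal_union_add_inter (μ := gaussVec n) (s := {x | |∑ i ∈ S, x i| ≤ d}) (hm T)]

/-- The probability that a centered Gaussian of variance `k` lies in `[-d, d]`. -/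
noncomputable def centralMass (k : ℕ) (d : ℝ) : ℝ := (gaussianReal 0 (k : ℝ≥0)).real {x | |x| ≤ d}

lemma gaussVec_real_abs_sum_le (n : ℕ) (S : Finset (Fin n)) (d : ℝ) :
    (gaussVec n).real {x | |∑ i ∈ S, x i| ≤ d} = centralMass S.card d := by
  rw [centralMass, Measure.real, Measure.real, gaussVec_abs_sum_le]

lemma gaussMat_real_FEvent (m n : ℕ) (d : ℝ) (S : Finset (Fin n)) :
    (gaussMat m n).real (FEvent m n d S) = (1 - centralMass S.card d) ^ m := by
  have h := gaussMat_real_FEvent_inter m n d S S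
  rw [Set.inter_self] at h
  rw [h, gaussVec_real_lt_inter]
  simp only [and_self, gaussVec_real_abs_sum_le]
  ring

lemma two_mul_div_sqrt_le {k d : ℝ} (hk : 0 < k) (hd : 0 ≤ d) :
    2 * d / √(2 * Real.pi * k) ≤ d / √k := by
  have h : 2 * √k ≤ √(2 * Real.pi * k) := by
    apply Real.le_sqrt_of_sq_le
    rw [mul_pow, Real.sq_sqrt hk.le]
    nlinarith [Real.pi_gt_three]
  have hk' : 0 < √k := Real.sqrt_pos.2 hk
  calc 2 * d / √(2 * Real.pi * k) ≤ 2 * d / (2 * √k) := by gcongr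
    _ = d / √k := by field_simp

lemma centralMass_le {k : ℕ} (hk : k ≠ 0) {d : ℝ} (hd : 0 ≤ d) :
    centralMass k d ≤ 2 * d / √(2 * Real.pi * k) := by
  have h := gaussianReal_abs_add_le (k : ℝ≥0) (by exact_mod_cast hk) 0 d
  simp only [zero_add] at h
  exact ENNReal.toReal_le_of_le_ofReal (by positivity) h

lemma le_centralMass {k : ℕ} (hk : k ≠ 0) {d : ℝ} (hd : 0 ≤ d) :
    2 * d / √(2 * Real.pi * k) * (1 - d ^ 2 / (2 * k)) ≤ centralMass k d :=
  (ENNReal.ofReal_le_iff_le_toReal (measure_ne_top _ _)).1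
    (le_gaussianReal_abs_le (k : ℝ≥0) (by exact_mod_cast hk) hd)

lemma centralMass_nonneg (k : ℕ) (d : ℝ) : 0 ≤ centralMass k d := measureReal_nonneg

/-- Two `k`-subsets sharing `t ≤ k / 2` elements have nearly independent row sums. -/
lemma gaussVec_real_inter_le {n k t : ℕ} (hk : k ≠ 0) {S T : Finset (Fin n)} (hS : S.card = k)
    (hT : (T \ S).card + t = k) (ht : 2 * t ≤ k) {d : ℝ} (hd : 0 ≤ d) :
    (gaussVec n).real {x | |∑ i ∈ S, x i| ≤ d ∧ |∑ i ∈ T, x i| ≤ d} ≤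
      centralMass k d ^ 2 + d ^ 2 / k * (t / k + d ^ 2 / (2 * k)) := by
  have hk0 : (0 : ℝ) < k := by exact_mod_cast Nat.pos_of_ne_zero hk
  have hcard : ((T \ S).card : ℝ) = k - t := by
    rw [← hT]
    push_cast
    ring
  have hpos : (T \ S).card ≠ 0 := by omega
  set p := centralMass k d with hp
  set s := 2 * d / √(2 * Real.pi * k) with hs
  have hs0 : 0 ≤ s := by positivity
  set r : ℝ := t / k with hr
  have hr0 : 0 ≤ r := by positivity
  have hr2 : r ≤ 1 / 2 := by
    rw [hr, div_le_iff₀ hk0]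
    have : (2 * t : ℝ) ≤ k := by exact_mod_cast ht
    linarith
  have h1 : (gaussVec n).real {x | |∑ i ∈ S, x i| ≤ d ∧ |∑ i ∈ T, x i| ≤ d} ≤
      2 * d / √(2 * Real.pi * (k - t)) * p := by
    have h := ENNReal.toReal_mono (ENNReal.mul_ne_top ENNReal.ofReal_ne_top (measure_ne_top _ _))
      (gaussVec_abs_sum_le_inter n S T hpos d)
    rw [ENNReal.toReal_mul, ENNReal.toReal_ofReal (by positivity), hcard] at h
    have h' := gaussVec_real_abs_sum_le n S d
    rw [hS, Measure.real] at h'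
    rwa [h'] at h
  have h2 : 2 * d / √(2 * Real.pi * (k - t)) ≤ s * (1 + r) := by
    have hkt : 2 * Real.pi * (k - t) = 2 * Real.pi * k * (1 - r) := by
      rw [hr]
      field_simp
    have hsq : 1 / √(1 - r) ≤ 1 + r := by
      rw [div_le_iff₀ (Real.sqrt_pos.2 (by linarith))]
      have : √((1 + r) ^ 2 * (1 - r)) = (1 + r) * √(1 - r) := by
        rw [Real.sqrt_mul (by positivity), Real.sqrt_sq (by linarith)]
      rw [← this]
      apply Real.le_sqrt_of_sq_le
      nlinarith [mul_nonneg hr0 (show 0 ≤ 1 - r - r ^ 2 by nlinarith)]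
    rw [hkt, Real.sqrt_mul (by positivity)]
    calc 2 * d / (√(2 * Real.pi * k) * √(1 - r)) = s * (1 / √(1 - r)) := by
          rw [hs]
          field_simp
      _ ≤ s * (1 + r) := by gcongr
  have h3 : p ≤ s := centralMass_le hk hd
  have h4 : s * (1 - d ^ 2 / (2 * k)) ≤ p := le_centralMass hk hd
  have h5 : s ≤ d / √k := two_mul_div_sqrt_le hk0 hd
  have hp0 : 0 ≤ p := centralMass_nonneg k d
  have h6 : s ^ 2 ≤ d ^ 2 / k := by
    calc s ^ 2 ≤ (d / √k) ^ 2 := by gcongr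
      _ = d ^ 2 / k := by rw [div_pow, Real.sq_sqrt hk0.le]
  set w := d ^ 2 / (2 * (k : ℝ)) with hw
  have hw0 : 0 ≤ w := by positivity
  calc _ ≤ 2 * d / √(2 * Real.pi * (k - t)) * p := h1
    _ ≤ s * (1 + r) * p := by gcongr
    _ = s * (1 - w) * p + p * s * (r + w) := by ring
    _ ≤ p * p + s * s * (r + w) := by gcongr
    _ ≤ p ^ 2 + d ^ 2 / k * (r + w) := by
      rw [← sq, ← sq]
      gcongr

lemma one_sub_two_mul_add_pow_le {p q θ : ℝ} (hp2 : p ≤ 1 / 2) (hθ : 0 ≤ θ)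
    (hq : q ≤ p ^ 2 + θ) (h0 : 0 ≤ 1 - p - p + q) (m : ℕ) :
    (1 - p - p + q) ^ m ≤ ((1 - p) ^ m) ^ 2 * Real.exp (4 * m * θ) := by
  have h1 : 1 - p - p + q ≤ (1 - p) ^ 2 * Real.exp (4 * θ) := by
    have h2 := Real.add_one_le_exp (4 * θ)
    have h3 : 1 / 4 ≤ (1 - p) ^ 2 := by nlinarith
    calc 1 - p - p + q ≤ (1 - p) ^ 2 + θ := by linarith
      _ ≤ (1 - p) ^ 2 * (4 * θ + 1) := by nlinarith
      _ ≤ _ := by gcongr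
  calc (1 - p - p + q) ^ m ≤ ((1 - p) ^ 2 * Real.exp (4 * θ)) ^ m := by gcongr
    _ = _ := by
      rw [mul_pow, ← pow_mul, ← pow_mul, mul_comm 2 m, ← Real.exp_nat_mul]
      ring_nf

end Events

section Main

/-- The pair correlation of the events attached to two `k`-sets, in terms of their overlap `t`. -/
lemma gaussMat_real_FEvent_inter_le {n k m t : ℕ} (hk : k ≠ 0) {S T : Finset (Fin n)}
    (hS : S.card = k) (hT : T.card = k) (hTS : (T \ S).card + t = k) {d : ℝ} (hd : 0 ≤ d)
    (hdk : d ≤ √k / 2) (hL : 0 ≤ Real.log k) (hmd3 : m * d ^ 3 ≤ k * √k / 32)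
    (hmd : m * d ≤ k * √k * Real.log k / 32) :
    (gaussMat m n).real (FEvent m n d S ∩ FEvent m n d T) ≤
      ((1 - centralMass k d) ^ m) ^ 2 *
        (Real.exp (1 / 32) * Real.exp (√(k * Real.log k) / (8 * k)) ^ t +
          Real.exp (-(k * Real.log k / 8)) * Real.exp (Real.log k / 2) ^ t) := by
  have hk0 : (0 : ℝ) < k := by exact_mod_cast Nat.pos_of_ne_zero hk
  have hsk : 0 < √(k : ℝ) := Real.sqrt_pos.2 hk0
  have hss : √(k : ℝ) * √k = k := Real.mul_self_sqrt hk0.le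
  set L := Real.log k with hLdef
  set p := centralMass k d with hp
  have hps : p ≤ d / √k := (centralMass_le hk hd).trans (two_mul_div_sqrt_le hk0 hd)
  have hp2 : p ≤ 1 / 2 := hps.trans (by rw [div_le_iff₀ hsk]; linarith)
  have hp0 : 0 ≤ p := centralMass_nonneg k d
  have hpS : (gaussVec n).real {x | |∑ i ∈ S, x i| ≤ d} = p := by
    rw [gaussVec_real_abs_sum_le, hS]
  have hpT : (gaussVec n).real {x | |∑ i ∈ T, x i| ≤ d} = p := by
    rw [gaussVec_real_abs_sum_le, hT]
  have h0 := gaussVec_real_lt_inter n d S T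
  rw [hpS, hpT] at h0
  have h0' := h0 ▸ measureReal_nonneg (μ := gaussVec n)
    (s := {x | d < |∑ i ∈ S, x i| ∧ d < |∑ i ∈ T, x i|})
  rw [gaussMat_real_FEvent_inter, h0, ← Real.exp_nat_mul, ← Real.exp_nat_mul, ← Real.exp_add,
    ← Real.exp_add]
  by_cases ht : 2 * t ≤ k
  · refine (one_sub_two_mul_add_pow_le hp2 (by positivity)
      (gaussVec_real_inter_le hk hS hTS ht hd) h0' m).trans ?_
    gcongr
    refine le_add_of_le_of_nonneg ?_ (Real.exp_nonneg _)
    rw [Real.exp_le_exp]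
    have hmd2 : m * d ^ 2 ≤ k * √(k * L) / 32 := by
      apply le_of_sq_le_sq ?_ (by positivity)
      have h1 : (m * d ^ 2) ^ 2 = (m * d ^ 3) * (m * d) := by ring
      have h2 : (k * √(k * L) / 32) ^ 2 = (k * √k / 32) * (k * √k * L / 32) := by
        rw [div_pow, mul_pow, Real.sq_sqrt (by positivity)]
        linear_combination (-(k : ℝ) ^ 2 * L / 1024) * hss
      rw [h1, h2]
      gcongr
    have hA : 4 * m * (d ^ 2 / k * (t / k)) ≤ t * (√(k * L) / (8 * k)) := by
      calc 4 * m * (d ^ 2 / k * (t / k)) = (m * d ^ 2) * (4 * t / k ^ 2) := by field_simp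
        _ ≤ (k * √(k * L) / 32) * (4 * t / k ^ 2) := by gcongr
        _ = t * (√(k * L) / (8 * k)) := by field_simp; ring
    have hB : 4 * m * (d ^ 2 / k * (d ^ 2 / (2 * k))) ≤ 1 / 32 := by
      calc 4 * m * (d ^ 2 / k * (d ^ 2 / (2 * k))) = (m * d ^ 3) * d * (2 / k ^ 2) := by
            field_simp; ring
        _ ≤ (k * √k / 32) * (√k / 2) * (2 / k ^ 2) := by gcongr
        _ = (√k * √k) * (1 / (32 * k)) := by field_simp
        _ = 1 / 32 := by rw [hss]; field_simp
    linarith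
  · have hq : (gaussVec n).real {x | |∑ i ∈ S, x i| ≤ d ∧ |∑ i ∈ T, x i| ≤ d} ≤ p ^ 2 + p := by
      have : (gaussVec n).real {x | |∑ i ∈ S, x i| ≤ d ∧ |∑ i ∈ T, x i| ≤ d} ≤
          (gaussVec n).real {x | |∑ i ∈ S, x i| ≤ d} := measureReal_mono fun x hx => hx.1
      rw [hpS] at this
      nlinarith [sq_nonneg p]
    refine (one_sub_two_mul_add_pow_le hp2 hp0 hq h0' m).trans ?_
    gcongr
    refine le_add_of_nonneg_of_le (Real.exp_nonneg _) ?_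
    rw [Real.exp_le_exp]
    have ht' : (k : ℝ) ≤ 2 * t := by exact_mod_cast (not_le.1 ht).le
    calc 4 * m * p ≤ 4 * m * (d / √k) := by gcongr
      _ = (m * d) * (4 / √k) := by ring
      _ ≤ (k * √k * L / 32) * (4 / √k) := by gcongr
      _ = k * L / 8 := by field_simp; ring
      _ ≤ -(k * L / 8) + t * (L / 2) := by nlinarith

lemma sum_pair_weight_le {k B : ℕ} {L : ℝ} (hk : 3 ≤ k) (hL : 16 ≤ L) (hexp : Real.exp L = k)
    (hB : √(k * L) ≤ B) (f : Fin k → Fin B) :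
    ∑ g, (Real.exp (1 / 32) * Real.exp (√(k * L) / (8 * k)) ^ agreement f g +
      Real.exp (-(k * L / 8)) * Real.exp (L / 2) ^ agreement f g) ≤ 2 * (B : ℝ) ^ k := by
  have hk0 : (0 : ℝ) < k := by positivity
  have hk3 : (3 : ℝ) ≤ k := by exact_mod_cast hk
  have hsqrt0 : 0 < √(k * L) := Real.sqrt_pos.2 (by positivity)
  have hB0 : (0 : ℝ) < B := hsqrt0.trans_le hB
  have hLk : L ≤ k := by
    have := Real.add_one_le_exp L
    linarith
  rw [Finset.sum_add_distrib, ← Finset.mul_sum, ← Finset.mul_sum, sum_pow_agreement,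
    sum_pow_agreement]
  set δ := √(k * L) / (8 * k) with hδ
  have hδ0 : 0 ≤ δ := by positivity
  have hδ1 : δ ≤ 1 := by
    rw [hδ, div_le_one (by positivity)]
    calc √(k * L) ≤ √(k * k) := by gcongr
      _ = k := Real.sqrt_mul_self hk0.le
      _ ≤ 8 * k := by linarith
  have hexpδ : Real.exp δ - 1 ≤ 2 * δ := by
    have := Real.abs_exp_sub_one_le (x := δ) (by rwa [abs_of_nonneg hδ0])
    rw [abs_of_nonneg hδ0] at this
    exact (le_abs_self _).trans this
  have h1 : (B + (Real.exp δ - 1)) ^ k ≤ (B : ℝ) ^ k * Real.exp (1 / 4) := by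
    have hstep : B + (Real.exp δ - 1) ≤ B * Real.exp (1 / (4 * k)) := by
      have h2 := Real.add_one_le_exp (1 / (4 * (k : ℝ)))
      have h3 : 2 * δ ≤ B * (1 / (4 * k)) := by
        calc 2 * δ = √(k * L) * (1 / (4 * k)) := by rw [hδ]; field_simp; norm_num
          _ ≤ B * (1 / (4 * k)) := by gcongr
      nlinarith
    have hnn : 0 ≤ B + (Real.exp δ - 1) := by
      have := Real.one_le_exp hδ0
      linarith
    calc (B + (Real.exp δ - 1)) ^ k ≤ (B * Real.exp (1 / (4 * k))) ^ k := by gcongr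
      _ = (B : ℝ) ^ k * Real.exp (1 / 4) := by
        rw [mul_pow, ← Real.exp_nat_mul]
        congr 2
        field_simp
  have h2 : (B + (Real.exp (L / 2) - 1)) ^ k ≤ (B : ℝ) ^ k * Real.exp k := by
    have hLB : Real.exp (L / 2) ≤ B := by
      refine le_trans ?_ hB
      apply Real.le_sqrt_of_sq_le
      rw [← Real.exp_nat_mul, Nat.cast_ofNat, mul_div_cancel₀ _ two_ne_zero, hexp]
      nlinarith
    have hnn : 0 ≤ B + (Real.exp (L / 2) - 1) := by
      have := Real.one_le_exp (show 0 ≤ L / 2 by linarith)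
      linarith
    calc (B + (Real.exp (L / 2) - 1)) ^ k ≤ (B * Real.exp 1) ^ k := by
          gcongr
          nlinarith [Real.exp_one_gt_d9]
      _ = (B : ℝ) ^ k * Real.exp k := by
        rw [mul_pow, ← Real.exp_nat_mul, mul_one]
  have h3 : Real.exp (1 / 32) * Real.exp (1 / 4) ≤ 3 / 2 := by
    rw [← Real.exp_add]
    have h := Real.add_one_le_exp (-(1 / 32 + 1 / 4) : ℝ)
    rw [Real.exp_neg] at h
    rw [← inv_le_inv₀ (by norm_num) (Real.exp_pos _)]
    linarith
  have h4 : Real.exp (-(k * L / 8)) * Real.exp k ≤ 1 / 2 := by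
    rw [← Real.exp_add]
    have h5 : -(k * L / 8) + k ≤ -(k : ℝ) := by nlinarith
    refine (Real.exp_le_exp.2 h5).trans ?_
    rw [Real.exp_neg, inv_le_comm₀ (Real.exp_pos _) (by norm_num)]
    have := Real.add_one_le_exp (k : ℝ)
    linarith
  have hBk : 0 < (B : ℝ) ^ k := by positivity
  calc _ ≤ Real.exp (1 / 32) * ((B : ℝ) ^ k * Real.exp (1 / 4)) +
        Real.exp (-(k * L / 8)) * ((B : ℝ) ^ k * Real.exp k) := by gcongr
    _ = (B : ℝ) ^ k * (Real.exp (1 / 32) * Real.exp (1 / 4)) +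
        (B : ℝ) ^ k * (Real.exp (-(k * L / 8)) * Real.exp k) := by ring
    _ ≤ (B : ℝ) ^ k * (3 / 2) + (B : ℝ) ^ k * (1 / 2) := by gcongr
    _ = 2 * (B : ℝ) ^ k := by ring

lemma half_le_gaussMat_real_not_isBalanced {n k m : ℕ} (hk : k ≠ 0) (hL : 16 ≤ Real.log k)
    (hn : 2 * k * √(k * Real.log k) ≤ n) {d : ℝ} (hd : 0 ≤ d) (hdk : d ≤ √k / 2)
    (hmd3 : m * d ^ 3 ≤ k * √k / 32) (hmd : m * d ≤ k * √k * Real.log k / 32) :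
    1 / 2 ≤ (gaussMat m n).real {v | ¬ IsBalanced n k d (Set.range v)} := by
  have hk0 : (0 : ℝ) < k := by exact_mod_cast Nat.pos_of_ne_zero hk
  have hexp : Real.exp (Real.log k) = k := Real.exp_log hk0
  have hk3 : (3 : ℝ) ≤ k := by
    have := Real.add_one_le_exp (Real.log k)
    linarith
  have hsq1 : 1 ≤ √(k * Real.log k) := Real.one_le_sqrt.2 (by nlinarith)
  set B := n / k with hBdef
  have hB : √(k * Real.log k) ≤ B := by
    have h1 : (n : ℝ) < k * (B + 1) := by
      exact_mod_cast Nat.lt_mul_div_succ n (Nat.pos_of_ne_zero hk)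
    have h2 : 2 * √(k * Real.log k) < B + 1 := by
      refine lt_of_mul_lt_mul_left ?_ hk0.le
      linarith
    linarith
  have hB0 : (0 : ℝ) < B := by linarith
  obtain ⟨e⟩ : Nonempty (Fin k × Fin B ↪ Fin n) := by
    apply Function.Embedding.nonempty_of_card_le
    simpa using Nat.mul_div_le n k
  have hk3' : 3 ≤ k := by exact_mod_cast hk3
  set p := centralMass k d with hp
  have hp1 : p < 1 := by
    have hps : p ≤ d / √k := (centralMass_le hk hd).trans (two_mul_div_sqrt_le hk0 hd)
    have : d / √k ≤ 1 / 2 := by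
      rw [div_le_iff₀ (Real.sqrt_pos.2 hk0)]
      linarith
    linarith
  set P := (1 - p) ^ m with hP
  have hP0 : 0 < P := pow_pos (by linarith) m
  have hmain := half_le_measureReal_iUnion (gaussMat m n)
    (F := fun f : Fin k → Fin B => FEvent m n d (transversal e f))
    (fun f => measurableSet_FEvent m n d _) (M := (B : ℝ) ^ k * P) (by positivity)
    (by simp [gaussMat_real_FEvent, card_transversal, hP, hp]) (by
      have hrow : ∀ f : Fin k → Fin B, ∑ g, (gaussMat m n).real
          (FEvent m n d (transversal e f) ∩ FEvent m n d (transversal e g)) ≤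
          P ^ 2 * (2 * (B : ℝ) ^ k) := by
        intro f
        refine (Finset.sum_le_sum fun g _ => gaussMat_real_FEvent_inter_le hk
          (card_transversal e f) (card_transversal e g) (card_transversal_sdiff_add e f g) hd hdk
          (by linarith) hmd3 hmd).trans ?_
        rw [← Finset.mul_sum]
        gcongr
        exact sum_pair_weight_le hk3' hL hexp hB f
      refine (Finset.sum_le_sum fun f _ => hrow f).trans (le_of_eq ?_)
      simp
      ring)
  refine hmain.trans (measureReal_mono ?_)
  intro v hv hbal
  obtain ⟨f, hf⟩ := Set.mem_iUnion.1 hv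
  obtain ⟨_, ⟨j, rfl⟩, hj⟩ := hbal _ (card_transversal e f)
  exact absurd hj (not_le.2 (hf j))

end Main

lemma eventually_log_bounds {ε : ℝ} (hε : 0 < ε) :
    ∀ᶠ k : ℕ in Filter.atTop, 1 ≤ k ∧ 16 ≤ Real.log k ∧ 32 * Real.log k ≤ k ∧
      2 * √(Real.log k) ≤ (k : ℝ) ^ (1.5 * ε) := by
  have hcast := tendsto_natCast_atTop_atTop (R := ℝ)
  have h1 := (Real.tendsto_log_atTop.comp hcast).eventually_ge_atTop 16
  have h2 := hcast.eventually
    ((isLittleO_log_rpow_atTop (r := 1) one_pos).bound (c := 1 / 32) (by norm_num))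
  have h3 := hcast.eventually
    ((isLittleO_log_rpow_atTop (r := 1.5 * ε) (by positivity)).bound (c := 1 / 2) (by norm_num))
  filter_upwards [Filter.eventually_ge_atTop 1, h1, h2, h3] with k hk h1 h2 h3
  simp only [Function.comp] at h1
  have hL : 0 ≤ Real.log k := by linarith
  rw [Real.norm_of_nonneg hL, Real.norm_of_nonneg (by positivity)] at h2 h3
  rw [Real.rpow_one] at h2
  refine ⟨hk, h1, by linarith, ?_⟩
  have : √(Real.log k) ≤ Real.log k := by
    rw [Real.sqrt_le_left hL]
    nlinarith
  linarith

/-- with `m ≤ c·(k^{1.5}/d)·min(1/d², log k)` i.i.d. Gaussian vectors,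
the resulting set fails to be `(n, k, d)`-balanced with probability at least `1/2`. -/
theorem gaussian_balancing_lower_bound (ε : ℝ) (hε1 : 0 < ε) (hε2 : ε < 2/3) :
    ∃ c : ℝ, 0 < c ∧ ∃ N : ℕ, ∀ n k m : ℕ, N ≤ n → N ≤ k →
      (k : ℝ) ≤ (n : ℝ) ^ ((2:ℝ)/3 - ε) →
      ∀ d : ℝ,
        max ((4:ℝ) ^ (1/(1+ε)) * (k : ℝ) ^ (1.5:ℝ) / (n : ℝ) ^ (1/(1+ε)))
            ((k : ℝ) ^ (ε - 0.5) * Real.sqrt (4 * Real.log m)) ≤ d →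
        d ≤ Real.sqrt (4 * Real.log m) →
        (m : ℝ) ≤ c * ((k : ℝ) ^ (1.5:ℝ) / d) * min (1/d^2) (Real.log k) →
        gaussMat m n {v | ¬ IsBalanced n k d (Set.range v)} ≥ 1/2 := by
  obtain ⟨N, hN⟩ := Filter.eventually_atTop.1 (eventually_log_bounds hε1)
  refine ⟨1 / 32, by norm_num, max N 1, fun n k m hNn hNk hkn d hdl hdu hm => ?_⟩
  obtain ⟨hk1, hL, hLk, hLε⟩ := hN k (le_of_max_le_left hNk)
  have hn1 : (1 : ℝ) ≤ n := by exact_mod_cast le_of_max_le_right hNn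
  have hk0 : (0 : ℝ) < k := by exact_mod_cast hk1
  have hn0 : (0 : ℝ) < n := by linarith
  have hd : 0 < d := lt_of_lt_of_le (by positivity) ((le_max_left _ _).trans hdl)
  have hk15 : (k : ℝ) ^ (1.5 : ℝ) = k * √k := by
    rw [Real.sqrt_eq_rpow, ← Real.rpow_one_add' hk0.le (by norm_num)]
    norm_num
  rw [hk15] at hm
  have hmd3 : m * d ^ 3 ≤ k * √k / 32 := by
    calc m * d ^ 3 ≤ (1 / 32 * (k * √k / d) * (1 / d ^ 2)) * d ^ 3 := by
          gcongr
          exact hm.trans (by gcongr; exact min_le_left _ _)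
      _ = k * √k / 32 := by field_simp
  have hmd : m * d ≤ k * √k * Real.log k / 32 := by
    calc m * d ≤ (1 / 32 * (k * √k / d) * Real.log k) * d := by
          gcongr
          exact hm.trans (by gcongr; exact min_le_right _ _)
      _ = k * √k * Real.log k / 32 := by field_simp
  have hsize : 2 * k * √(k * Real.log k) ≤ n := by
    calc 2 * k * √(k * Real.log k) = (2 * √(Real.log k)) * (k * √k) := by
          rw [Real.sqrt_mul hk0.le]
          ring
      _ ≤ (k : ℝ) ^ (1.5 * ε) * (k : ℝ) ^ (1.5 : ℝ) := by
          rw [hk15]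
          gcongr
      _ = (k : ℝ) ^ (1.5 * ε + 1.5) := (Real.rpow_add hk0 _ _).symm
      _ ≤ ((n : ℝ) ^ ((2 : ℝ) / 3 - ε)) ^ (1.5 * ε + 1.5) := by gcongr
      _ = (n : ℝ) ^ (((2 : ℝ) / 3 - ε) * (1.5 * ε + 1.5)) := (Real.rpow_mul hn0.le _ _).symm
      _ ≤ (n : ℝ) ^ (1 : ℝ) := Real.rpow_le_rpow_of_exponent_le hn1 (by nlinarith)
      _ = n := Real.rpow_one _
  have hdk : d ≤ √k / 2 := by
    have hk4 : (4 : ℝ) ≤ k := by linarith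
    have hsq : d ^ 2 ≤ k / 4 := by
      rcases le_total d 1 with h | h
      · nlinarith
      · have hlog : 0 < Real.log m := by
          have := Real.sqrt_pos.1 (hd.trans_le hdu)
          linarith
        have hd2 : d ^ 2 ≤ 4 * Real.log m := by
          rw [← Real.sq_sqrt (show 0 ≤ 4 * Real.log m by linarith)]
          gcongr
        have hm0 : (0 : ℝ) < m := by
          rcases Nat.eq_zero_or_pos m with rfl | h0
          · simp at hlog
          · exact_mod_cast h0
        have hmk : (m : ℝ) ≤ k * k := by
          have h1 : (m : ℝ) ≤ m * d ^ 3 := le_mul_of_one_le_right hm0.le (one_le_pow₀ h)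
          have h2 : √(k : ℝ) ≤ k := by
            rw [Real.sqrt_le_left hk0.le]
            nlinarith
          nlinarith
        have hlogm : Real.log m ≤ Real.log k + Real.log k := by
          rw [← Real.log_mul hk0.ne' hk0.ne']
          exact Real.log_le_log hm0 hmk
        linarith
    have : √k / 2 = √((k : ℝ) / 4) := by
      rw [Real.sqrt_div hk0.le, show (4 : ℝ) = 2 ^ 2 by norm_num, Real.sqrt_sq (by norm_num)]
    rw [this]
    exact Real.le_sqrt_of_sq_le hsq
  have hmain := half_le_gaussMat_real_not_isBalanced (n := n) (m := m) (by omega) hL hsize hd.le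
    hdk hmd3 hmd
  rw [ge_iff_le, show (1 / 2 : ℝ≥0∞) = ENNReal.ofReal (1 / 2) by
    rw [ENNReal.ofReal_div_of_pos (by norm_num)]; simp]
  exact (ENNReal.ofReal_le_iff_le_toReal (measure_ne_top _ _)).2 hmain
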